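/- For every n ≥ 3, the Stanley depth of the family Q_n = {σ ⊆ [n] : 1 ∈ σ, n ∈ σ, and σ contains no pair {i,i+1} with 1 ≤ i ≤ n−1} equals ⌈(n+2)/3⌉. (Q_n is the characteristic poset of the quotient J_n/I_n of the edge ideal of the n-cycle by the edge ideal of the n-line, so by Herzog–Vladoiu–Zheng this says sdepth(J_n/I_n) = ⌈(n+2)/3⌉.) -/

import Mathlib

/-- A subset `σ` of `[n] = {1,…,n}` is *cyclically independent* if it is an
independent set of the cycle graph `C_n`: it contains no pair `{i, i+1}` with
`1 ≤ i ≤ n-1`, and it does not contain both `1` and `n`. -/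
def CyclicIndep (n : ℕ) (σ : Finset ℕ) : Prop :=
  σ ⊆ Finset.Icc 1 n ∧
    (∀ i : ℕ, 1 ≤ i → i ≤ n - 1 → ¬(i ∈ σ ∧ i + 1 ∈ σ)) ∧
    ¬(1 ∈ σ ∧ n ∈ σ)

/-- A partition of a family `P` of subsets of `[n] = {1,…,n}` into finitely many
pairwise disjoint intervals `[F i, G i] = {σ : F i ⊆ σ ⊆ G i}`, each contained in
`P`, whose union is `P`.  (The interval `[F, G]` is `Finset.Icc F G`.) -/
structure IntervalPartition (n : ℕ) (P : Set (Finset ℕ)) where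
  r : ℕ
  F : Fin r → Finset ℕ
  G : Fin r → Finset ℕ
  le : ∀ i, F i ⊆ G i
  sub : ∀ i, G i ⊆ Finset.Icc 1 n
  disj : ∀ i j, i ≠ j → Disjoint (Finset.Icc (F i) (G i)) (Finset.Icc (F j) (G j))
  cover : ∀ σ : Finset ℕ, σ ∈ P ↔ ∃ i, σ ∈ Finset.Icc (F i) (G i)

/-- The sdepth of a partition `P = ⋃ i, [F i, G i]` is `min i, |G i|`; the Stanley
depth of `P` is the maximum of this quantity over all interval partitions of `P`,
i.e. the largest `k` such that `P` admits a partition all of whose upper ends `G i`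
have at least `k` elements. -/
noncomputable def stanleyDepth (n : ℕ) (P : Set (Finset ℕ)) : ℕ :=
  sSup {k : ℕ | ∃ part : IntervalPartition n P, ∀ i, k ≤ (part.G i).card}

/-- `P` has an interval partition, given by the finite set of pairs of interval ends, all of
whose upper ends have at least `k` elements. -/
def HasIntervalPartition (P : Set (Finset ℕ)) (k : ℕ) : Prop :=
  ∃ S : Finset (Finset ℕ × Finset ℕ),
    (∀ p ∈ S, p.1 ⊆ p.2 ∧ k ≤ p.2.card ∧ ∀ σ, p.1 ⊆ σ → σ ⊆ p.2 → σ ∈ P) ∧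
    (∀ σ ∈ P, ∃ p ∈ S, p.1 ⊆ σ ∧ σ ⊆ p.2) ∧
    ∀ σ, ∀ p ∈ S, ∀ q ∈ S, p.1 ⊆ σ → σ ⊆ p.2 → q.1 ⊆ σ → σ ⊆ q.2 → p = q

namespace HasIntervalPartition

variable {P Q : Set (Finset ℕ)} {k l v : ℕ}

lemma mono (h : HasIntervalPartition P k) (hl : l ≤ k) : HasIntervalPartition P l := by
  obtain ⟨S, h₁, h₂⟩ := h
  exact ⟨S, fun p hp => ⟨(h₁ p hp).1, hl.trans (h₁ p hp).2.1, (h₁ p hp).2.2⟩, h₂⟩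

lemma singleton_empty : HasIntervalPartition {∅} 0 := by
  refine ⟨{(∅, ∅)}, ?_, ?_, ?_⟩
  · simp
  · simp
  · simp

lemma union (hP : HasIntervalPartition P k) (hQ : HasIntervalPartition Q k)
    (hd : Disjoint P Q) : HasIntervalPartition (P ∪ Q) k := by
  obtain ⟨S, hS, hSc, hSd⟩ := hP
  obtain ⟨T, hT, hTc, hTd⟩ := hQ
  rw [Set.disjoint_left] at hd
  refine ⟨S ∪ T, ?_, ?_, ?_⟩
  · intro p hp
    rcases Finset.mem_union.1 hp with hp | hp
    · obtain ⟨h₁, h₂, h₃⟩ := hS p hp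
      exact ⟨h₁, h₂, fun σ a b => Or.inl (h₃ σ a b)⟩
    · obtain ⟨h₁, h₂, h₃⟩ := hT p hp
      exact ⟨h₁, h₂, fun σ a b => Or.inr (h₃ σ a b)⟩
  · rintro σ (hσ | hσ)
    · obtain ⟨p, hp, h⟩ := hSc σ hσ
      exact ⟨p, Finset.mem_union_left _ hp, h⟩
    · obtain ⟨p, hp, h⟩ := hTc σ hσ
      exact ⟨p, Finset.mem_union_right _ hp, h⟩
  · intro σ p hp q hq a b c d
    rcases Finset.mem_union.1 hp with hp | hp <;> rcases Finset.mem_union.1 hq with hq | hq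
    · exact hSd σ p hp q hq a b c d
    · exact absurd ((hT q hq).2.2 σ c d) (hd ((hS p hp).2.2 σ a b))
    · exact absurd ((hT p hp).2.2 σ a b) (hd ((hS q hq).2.2 σ c d))
    · exact hTd σ p hp q hq a b c d

/-- Adjoining a new vertex to every member of the family. -/
lemma insert (hP : HasIntervalPartition P k) (hv : ∀ σ ∈ P, v ∉ σ) :
    HasIntervalPartition {σ | v ∈ σ ∧ σ.erase v ∈ P} (k + 1) := by
  obtain ⟨S, hS, hSc, hSd⟩ := hP
  have hv₂ : ∀ p ∈ S, v ∉ p.2 := fun p hp => hv _ ((hS p hp).2.2 _ (hS p hp).1 subset_rfl)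
  have hv₁ : ∀ p ∈ S, v ∉ p.1 := fun p hp => hv _ ((hS p hp).2.2 _ subset_rfl (hS p hp).1)
  have key : ∀ p ∈ S, ∀ σ, Insert.insert v p.1 ⊆ σ → σ ⊆ Insert.insert v p.2 →
      p.1 ⊆ σ.erase v ∧ σ.erase v ⊆ p.2 := by
    intro p hp σ a b
    have := hv₁ p hp
    constructor <;> grind
  refine ⟨S.image fun p => (Insert.insert v p.1, Insert.insert v p.2), ?_, ?_, ?_⟩
  · simp only [Finset.forall_mem_image]
    intro p hp
    obtain ⟨h₁, h₂, h₃⟩ := hS p hp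
    refine ⟨Finset.insert_subset_insert _ h₁, ?_, fun σ a b => ?_⟩
    · rw [Finset.card_insert_of_notMem (hv₂ p hp)]; omega
    · exact ⟨a (Finset.mem_insert_self _ _), h₃ _ (key p hp σ a b).1 (key p hp σ a b).2⟩
  · rintro σ ⟨hσ, hσ'⟩
    obtain ⟨p, hp, a, b⟩ := hSc _ hσ'
    refine ⟨_, Finset.mem_image_of_mem _ hp, ?_, ?_⟩
    · grind
    · grind
  · simp only [Finset.forall_mem_image]
    intro σ p hp q hq a b c d
    rw [hSd _ p hp q hq (key p hp σ a b).1 (key p hp σ a b).2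
      (key q hq σ c d).1 (key q hq σ c d).2]

/-- Adjoining a new vertex freely. -/
lemma cone (hP : HasIntervalPartition P k) (hv : ∀ σ ∈ P, v ∉ σ) :
    HasIntervalPartition {σ | σ.erase v ∈ P} (k + 1) := by
  obtain ⟨S, hS, hSc, hSd⟩ := hP
  have hv₂ : ∀ p ∈ S, v ∉ p.2 := fun p hp => hv _ ((hS p hp).2.2 _ (hS p hp).1 subset_rfl)
  have hv₁ : ∀ p ∈ S, v ∉ p.1 := fun p hp => hv _ ((hS p hp).2.2 _ subset_rfl (hS p hp).1)
  have key : ∀ p ∈ S, ∀ σ, p.1 ⊆ σ → σ ⊆ Insert.insert v p.2 →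
      p.1 ⊆ σ.erase v ∧ σ.erase v ⊆ p.2 := by
    intro p hp σ a b
    have := hv₁ p hp
    constructor <;> grind
  refine ⟨S.image fun p => (p.1, Insert.insert v p.2), ?_, ?_, ?_⟩
  · simp only [Finset.forall_mem_image]
    intro p hp
    obtain ⟨h₁, h₂, h₃⟩ := hS p hp
    refine ⟨h₁.trans (Finset.subset_insert _ _), ?_, fun σ a b => ?_⟩
    · rw [Finset.card_insert_of_notMem (hv₂ p hp)]; omega
    · exact h₃ _ (key p hp σ a b).1 (key p hp σ a b).2
  · intro σ hσ
    obtain ⟨p, hp, a, b⟩ := hSc _ hσ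
    refine ⟨_, Finset.mem_image_of_mem _ hp, ?_, ?_⟩
    · grind
    · grind
  · simp only [Finset.forall_mem_image]
    intro σ p hp q hq a b c d
    rw [hSd _ p hp q hq (key p hp σ a b).1 (key p hp σ a b).2
      (key q hq σ c d).1 (key q hq σ c d).2]

lemma exists_intervalPartition {n : ℕ} (hP : HasIntervalPartition P k)
    (hn : ∀ σ ∈ P, σ ⊆ Finset.Icc 1 n) :
    ∃ part : IntervalPartition n P, ∀ i, k ≤ (part.G i).card := by
  obtain ⟨S, hS, hSc, hSd⟩ := hP
  let e := S.equivFin.symm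
  refine ⟨⟨S.card, fun i => (e i).1.1, fun i => (e i).1.2, fun i => (hS _ (e i).2).1,
    fun i => hn _ ((hS _ (e i).2).2.2 _ (hS _ (e i).2).1 subset_rfl), ?_, ?_⟩,
    fun i => (hS _ (e i).2).2.1⟩
  · intro i j hij
    rw [Finset.disjoint_left]
    intro σ hi hj
    rw [Finset.mem_Icc] at hi hj
    exact hij (e.injective (Subtype.ext
      (hSd σ _ (e i).2 _ (e j).2 hi.1 hi.2 hj.1 hj.2)))
  · intro σ
    simp only [Finset.mem_Icc]
    constructor
    · intro hσ
      obtain ⟨p, hp, h⟩ := hSc σ hσ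
      exact ⟨e.symm ⟨p, hp⟩, by simpa using h⟩
    · rintro ⟨i, a, b⟩
      exact (hS _ (e i).2).2.2 σ a b

end HasIntervalPartition

/-- The independent sets of the path on the `m` vertices `3, …, m + 2`. -/
def pathIndep (m : ℕ) : Set (Finset ℕ) :=
  {σ | (∀ x ∈ σ, 3 ≤ x ∧ x ≤ m + 2) ∧ ∀ i ∈ σ, i + 1 ∉ σ}

lemma pathIndep_zero : pathIndep 0 = {∅} := by
  ext σ
  simp only [pathIndep, Set.mem_ofPred_eq, Set.mem_singleton_iff]
  refine ⟨fun h => Finset.eq_empty_of_forall_notMem fun x hx => ?_, fun h => by simp [h]⟩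
  have := h.1 x hx
  omega

lemma pathIndep_one : pathIndep 1 = {σ | σ.erase 3 ∈ pathIndep 0} := by
  ext σ
  simp only [pathIndep, Set.mem_ofPred_eq, Finset.mem_erase]
  constructor
  · rintro ⟨h₁, h₂⟩
    exact ⟨fun x hx => by have := h₁ x hx.2; omega, fun i hi h => h₂ i hi.2 h.2⟩
  · rintro ⟨h₁, h₂⟩
    have h : ∀ x ∈ σ, x = 3 := fun x hx => by
      by_contra hne
      have := h₁ x ⟨hne, hx⟩
      omega
    exact ⟨fun x hx => by have := h x hx; omega, fun i hi hi' => by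
      have := h i hi
      have := h _ hi'
      omega⟩

/-- Split the independent sets according to whether they contain the penultimate vertex. -/
lemma pathIndep_add_two (m : ℕ) : pathIndep (m + 2) =
    {σ | m + 3 ∈ σ ∧ σ.erase (m + 3) ∈ pathIndep (m - 1)} ∪
      {σ | σ.erase (m + 4) ∈ pathIndep m} := by
  ext σ
  simp only [pathIndep, Set.mem_ofPred_eq, Finset.mem_erase, Set.mem_union]
  constructor
  · rintro ⟨h₁, h₂⟩
    by_cases hm : m + 3 ∈ σ
    · refine Or.inl ⟨hm, fun x hx => ?_, fun i hi h => h₂ i hi.2 h.2⟩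
      have := h₁ x hx.2
      have : x ≠ m + 4 := fun h => h₂ _ hm (h ▸ hx.2)
      have : x ≠ m + 2 := fun h => h₂ _ hx.2 (by subst h; exact hm)
      omega
    · refine Or.inr ⟨fun x hx => ?_, fun i hi h => h₂ i hi.2 h.2⟩
      have := h₁ x hx.2
      have : x ≠ m + 3 := fun h => hm (h ▸ hx.2)
      omega
  · rintro (⟨hm, h₁, h₂⟩ | ⟨h₁, h₂⟩)
    · refine ⟨fun x hx => ?_, fun i hi hi' => ?_⟩
      · by_cases h : x = m + 3
        · omega
        · have := h₁ x ⟨h, hx⟩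
          omega
      · by_cases h : i = m + 3
        · have := h₁ (i + 1) ⟨by omega, hi'⟩
          omega
        · have := h₁ i ⟨h, hi⟩
          exact h₂ i ⟨h, hi⟩ ⟨by omega, hi'⟩
    · refine ⟨fun x hx => ?_, fun i hi hi' => ?_⟩
      · by_cases h : x = m + 4
        · omega
        · have := h₁ x ⟨h, hx⟩
          omega
      · by_cases h : i = m + 4
        · have := h₁ (i + 1) ⟨by omega, hi'⟩
          omega
        · have := h₁ i ⟨h, hi⟩
          exact h₂ i ⟨h, hi⟩ ⟨by omega, hi'⟩

lemma notMem_of_mem_pathIndep {m v : ℕ} (hv : v < 3 ∨ m + 2 < v) :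
    ∀ σ ∈ pathIndep m, v ∉ σ := by
  intro σ hσ h
  have := hσ.1 v h
  omega

lemma hasIntervalPartition_pathIndep (m : ℕ) :
    HasIntervalPartition (pathIndep m) ((m + 2) / 3) := by
  induction m using Nat.strong_induction_on with
  | _ m ih =>
    match m with
    | 0 => rw [pathIndep_zero]; exact .singleton_empty
    | 1 =>
      rw [pathIndep_one]
      exact (ih 0 (by omega)).cone (notMem_of_mem_pathIndep (by omega))
    | m + 2 =>
      rw [pathIndep_add_two]
      refine .union ?_ ?_ ?_
      · exact ((ih (m - 1) (by omega)).insert (notMem_of_mem_pathIndep (by omega))).mono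
          (by omega)
      · exact ((ih m (by omega)).cone (notMem_of_mem_pathIndep (by omega))).mono (by omega)
      · rw [Set.disjoint_left]
        rintro σ ⟨hσ, -⟩ h
        have := h.1 (m + 3) (Finset.mem_erase.2 ⟨by omega, hσ⟩)
        omega

/-- Removing both end points identifies `Q_n` with the independent sets of a shorter path. -/
lemma pathIndep_erase_ends {n : ℕ} (hn : 3 ≤ n) :
    {σ : Finset ℕ | σ ⊆ Finset.Icc 1 n ∧ 1 ∈ σ ∧ n ∈ σ ∧
        ∀ i : ℕ, 1 ≤ i → i ≤ n - 1 → ¬(i ∈ σ ∧ i + 1 ∈ σ)} =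
      {σ | n ∈ σ ∧ σ.erase n ∈ {σ | 1 ∈ σ ∧ σ.erase 1 ∈ pathIndep (n - 4)}} := by
  ext σ
  simp only [pathIndep, Set.mem_ofPred_eq, Finset.mem_erase]
  constructor
  · rintro ⟨hs, h₁, hσ, h⟩
    refine ⟨hσ, ⟨by omega, h₁⟩, fun x hx => ?_, fun i hi hi' => ?_⟩
    · have := Finset.mem_Icc.1 (hs hx.2.2)
      have : x ≠ 2 := fun hx' => h 1 le_rfl (by omega) ⟨h₁, by subst hx'; exact hx.2.2⟩
      have : x ≠ n - 1 := fun hx' => h x (by omega) (by omega) ⟨hx.2.2, by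
        rwa [show x + 1 = n by omega]⟩
      omega
    · have := Finset.mem_Icc.1 (hs hi'.2.2)
      have := Finset.mem_Icc.1 (hs hi.2.2)
      exact h i (by omega) (by omega) ⟨hi.2.2, hi'.2.2⟩
  · rintro ⟨hσ, ⟨-, h₁⟩, hs, h⟩
    have hs' : ∀ x ∈ σ, x = 1 ∨ x = n ∨ (3 ≤ x ∧ x ≤ n - 4 + 2) := fun x hx => by
      by_cases hx₁ : x = 1
      · exact Or.inl hx₁
      by_cases hx₂ : x = n
      · exact Or.inr (Or.inl hx₂)
      exact Or.inr (Or.inr (hs x ⟨hx₁, hx₂, hx⟩))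
    have hs'' : ∀ x ∈ σ, 4 ≤ n ∨ x = 1 ∨ x = n := fun x hx => by
      by_contra! hc
      have := hs x ⟨hc.2.1, hc.2.2, hx⟩
      omega
    refine ⟨fun x hx => ?_, h₁, hσ, ?_⟩
    · have := hs' x hx
      have := hs'' x hx
      rw [Finset.mem_Icc]
      omega
    · rintro i hi hin ⟨a, b⟩
      have := hs' i a
      have := hs'' i a
      have := hs' _ b
      have := hs'' _ b
      exact h i ⟨by omega, by omega, a⟩ ⟨by omega, by omega, b⟩

/-- A small maximal member of `Q_n`. -/
def sparseIndep (n : ℕ) : Finset ℕ :=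
  insert n ((Finset.range ((n + 1) / 3)).image fun j => min (3 * j + 1) (n - 2))

lemma mem_sparseIndep {n x : ℕ} :
    x ∈ sparseIndep n ↔ x = n ∨ ∃ j < (n + 1) / 3, min (3 * j + 1) (n - 2) = x := by
  simp [sparseIndep]

lemma card_sparseIndep_le (n : ℕ) : (sparseIndep n).card ≤ (n + 4) / 3 := by
  have h₁ := Finset.card_insert_le n
    ((Finset.range ((n + 1) / 3)).image fun j => min (3 * j + 1) (n - 2))
  have h₂ := Finset.card_image_le (s := Finset.range ((n + 1) / 3))
    (f := fun j => min (3 * j + 1) (n - 2))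
  rw [Finset.card_range] at h₂
  rw [sparseIndep]
  omega

lemma sparseIndep_mem {n : ℕ} (hn : 3 ≤ n) :
    sparseIndep n ⊆ Finset.Icc 1 n ∧ 1 ∈ sparseIndep n ∧ n ∈ sparseIndep n ∧
      ∀ i : ℕ, 1 ≤ i → i ≤ n - 1 → ¬(i ∈ sparseIndep n ∧ i + 1 ∈ sparseIndep n) := by
  refine ⟨fun x hx => ?_, mem_sparseIndep.2 (Or.inr ⟨0, by omega, by omega⟩),
    mem_sparseIndep.2 (Or.inl rfl), ?_⟩
  · rw [Finset.mem_Icc]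
    obtain h | ⟨j, hj, h⟩ := mem_sparseIndep.1 hx <;> omega
  · simp only [mem_sparseIndep]
    rintro i hi hin ⟨h | ⟨j, hj, h⟩, h' | ⟨l, hl, h'⟩⟩ <;> omega

lemma subset_sparseIndep {n : ℕ} {τ : Finset ℕ} (hτ : τ ⊆ Finset.Icc 1 n)
    (hi : ∀ i : ℕ, 1 ≤ i → i ≤ n - 1 → ¬(i ∈ τ ∧ i + 1 ∈ τ)) (hs : sparseIndep n ⊆ τ) :
    τ ⊆ sparseIndep n := by
  intro x hx
  by_contra hxs
  have hmem := Finset.mem_Icc.1 (hτ hx)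
  have hxs' := hxs
  rw [mem_sparseIndep] at hxs'
  push Not at hxs'
  obtain ⟨hxn, hj⟩ := hxs'
  have hnext : x + 1 ∉ sparseIndep n := fun h => hi x (by omega) (by omega) ⟨hx, hs h⟩
  have hprev : x - 1 ∉ sparseIndep n := fun h => by
    have := Finset.mem_Icc.1 (hτ (hs h))
    exact hi (x - 1) (by omega) (by omega) ⟨hs h, by rwa [Nat.sub_add_cancel hmem.1]⟩
  rw [mem_sparseIndep] at hnext hprev
  push Not at hnext hprev
  have := hnext.1
  have := hj ((x - 1) / 3)
  have := hj ((x - 1) / 3 + 1)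
  have := hprev.2 ((x - 1) / 3)
  have := hnext.2 ((x - 1) / 3 + 1)
  omega

/-- For `n ≥ 3`, the Stanley depth of the family
`Q_n = {σ ⊆ [n] : 1 ∈ σ, n ∈ σ, σ contains no pair {i, i+1}, 1 ≤ i ≤ n-1}`
(the characteristic poset of `J_n / I_n`) equals `⌈(n+2)/3⌉` (which is `(n+4)/3`
in ℕ-division). -/
theorem stmt_8 (n : ℕ) (hn : 3 ≤ n) :
    stanleyDepth n {σ : Finset ℕ | σ ⊆ Finset.Icc 1 n ∧ 1 ∈ σ ∧ n ∈ σ ∧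
        ∀ i : ℕ, 1 ≤ i → i ≤ n - 1 → ¬(i ∈ σ ∧ i + 1 ∈ σ)} = (n + 4) / 3 := by
  refine IsGreatest.csSup_eq ⟨?_, ?_⟩
  · refine HasIntervalPartition.exists_intervalPartition ?_ fun σ hσ => hσ.1
    rw [pathIndep_erase_ends hn]
    have h := (hasIntervalPartition_pathIndep (n - 4)).insert
      (notMem_of_mem_pathIndep (v := 1) (by omega))
    refine (h.insert (v := n) ?_).mono (by omega)
    rintro σ ⟨-, hσ⟩ hnσ
    have := hσ.1 n (Finset.mem_erase.2 ⟨by omega, hnσ⟩)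
    omega
  · rintro k ⟨part, hk⟩
    obtain ⟨i, hi⟩ := (part.cover (sparseIndep n)).1 (sparseIndep_mem hn)
    have hG := (part.cover (part.G i)).2 ⟨i, Finset.mem_Icc.2 ⟨part.le i, le_rfl⟩⟩
    exact (hk i).trans ((Finset.card_le_card (subset_sparseIndep hG.1 hG.2.2.2
      (Finset.mem_Icc.1 hi).2)).trans (card_sparseIndep_le n))
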